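/- Let G be a group with a finite symmetric generating set S (e ∉ S) and let P be the lazy simple random walk measure. Suppose there are constants K, L > 0 and ν ∈ (0,1] such that |B_n| ≤ L·exp(K·n^ν) for all n ≥ 1, and a constant c > 0 such that |B_n| ≥ c·n² for all n ≥ 1. Then there exist constants K'', L'' > 0 such that P^{(2n)}(e) ≥ L''·exp(−K''·n^{ν/(2−ν)}) for all n ≥ 1. -/

import Mathlib

open scoped Classical

noncomputable section

/-- Word length of `g` with respect to the generating set `S`
(least `n` such that `g` is a product of `n` elements of `S`). -/
def wordLength {G : Type*} [Group G] (S : Set G) (g : G) : ℕ :=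
  sInf {n | ∃ l : List G, (∀ x ∈ l, x ∈ S) ∧ l.length = n ∧ l.prod = g}

/-- The ball of radius `n` with respect to the generating set `S`. -/
def ball {G : Type*} [Group G] (S : Set G) (n : ℕ) : Set G :=
  {g | wordLength S g ≤ n}

/-- The lazy simple random walk measure `P = (1/2)(δ_e + U_S)`. -/
def lazyWalk {G : Type*} [Group G] (S : Finset G) : G → ℝ := fun g =>
  (if g = 1 then (1 : ℝ) / 2 else 0) + (if g ∈ S then 1 / (2 * (S.card : ℝ)) else 0)

/-- The `n`-fold convolution power of a measure `P` (with `P^{(0)} = δ_e`). -/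
def convPow {G : Type*} [Group G] (P : G → ℝ) : ℕ → G → ℝ
  | 0 => fun g => if g = 1 then 1 else 0
  | n + 1 => fun g => ∑' h : G, convPow P n h * P (h⁻¹ * g)

/-- The speed (expected word length) of the walk at time `n`. -/
def speed {G : Type*} [Group G] (S : Set G) (P : G → ℝ) (n : ℕ) : ℝ :=
  ∑' g : G, convPow P n g * (wordLength S g : ℝ)

/-- The entropy of a measure `Q`, with the convention `0 · ln 0 = 0`. -/
def entropy {G : Type*} [Group G] (Q : G → ℝ) : ℝ :=
  -∑' g : G, Q g * Real.log (Q g)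

/-- A real Hilbert space equipped with an isometric linear `G`-representation and
a cocycle for it: `b (x y) = λ(x) b(y) + b(x)`. -/
structure HilbertCocycle (G : Type*) [Group G] where
  space : Type
  [nacg : NormedAddCommGroup space]
  [ips : InnerProductSpace ℝ space]
  [complete : CompleteSpace space]
  rep : G →* (space ≃ₗᵢ[ℝ] space)
  cocycle : G → space
  cocycle_rel : ∀ x y : G, cocycle (x * y) = rep x (cocycle y) + cocycle x

attribute [instance] HilbertCocycle.nacg HilbertCocycle.ips HilbertCocycle.complete

/-- The set of values at `x` of concave functions on `[0,∞)` dominating `f` on `ℕ`. -/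
def concaveMajorants (f : ℕ → ℝ) (x : ℝ) : Set ℝ :=
  {y | ∃ h : ℝ → ℝ, ConcaveOn ℝ (Set.Ici 0) h ∧ (∀ k : ℕ, f k ≤ h k) ∧ y = h x}

/-- The concave hull of `f : ℕ → ℝ`: the pointwise infimum of concave majorants. -/
def concaveHull (f : ℕ → ℝ) (x : ℝ) : ℝ := sInf (concaveMajorants f x)

/-- The log-volume of the ball of radius `n`. -/
def growthLog {G : Type*} [Group G] (S : Set G) (n : ℕ) : ℝ :=
  Real.log (Nat.card ↥(ball S n))

end

namespace MonoidAlgebra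

variable {G : Type*}

lemma summable_coeff_mul_coeff (a b : MonoidAlgebra ℝ G) :
    Summable fun g => a.coeff g * b.coeff g := by
  refine summable_of_hasFiniteSupport (a.coeff.support.finite_toSet.subset fun g hg => ?_)
  simp only [Function.mem_support] at hg
  simpa using left_ne_zero_of_mul hg

/-- The `ℓ²` inner product `∑ g, a g * b g` on the real monoid algebra. -/
noncomputable def l2Form (G : Type*) : LinearMap.BilinForm ℝ (MonoidAlgebra ℝ G) :=
  LinearMap.mk₂ ℝ (fun a b => ∑' g, a.coeff g * b.coeff g)
    (fun a a' b => by
      simp only [coeff_add, Finsupp.add_apply, add_mul]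
      exact (summable_coeff_mul_coeff a b).tsum_add (summable_coeff_mul_coeff a' b))
    (fun r a b => by
      simp only [coeff_smul, Finsupp.smul_apply, smul_eq_mul, mul_assoc, tsum_mul_left])
    (fun a b b' => by
      simp only [coeff_add, Finsupp.add_apply, mul_add]
      exact (summable_coeff_mul_coeff a b).tsum_add (summable_coeff_mul_coeff a b'))
    (fun r a b => by
      simp only [coeff_smul, Finsupp.smul_apply, smul_eq_mul, mul_left_comm _ r, tsum_mul_left])

lemma l2Form_apply (a b : MonoidAlgebra ℝ G) :
    l2Form G a b = ∑' g, a.coeff g * b.coeff g := rfl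

lemma l2Form_comm (a b : MonoidAlgebra ℝ G) : l2Form G a b = l2Form G b a := by
  simp only [l2Form_apply, mul_comm]

lemma l2Form_self_nonneg (a : MonoidAlgebra ℝ G) : 0 ≤ l2Form G a a :=
  tsum_nonneg fun _ => mul_self_nonneg _

lemma l2Form_sq_le (a b : MonoidAlgebra ℝ G) :
    l2Form G a b ^ 2 ≤ l2Form G a a * l2Form G b b :=
  LinearMap.BilinForm.apply_sq_le_of_symm _ l2Form_self_nonneg ⟨fun a b => l2Form_comm a b⟩ a b

lemma l2Form_self_eq_sum {a : MonoidAlgebra ℝ G} {t : Finset G} (ht : a.coeff.support ⊆ t) :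
    l2Form G a a = ∑ g ∈ t, a.coeff g ^ 2 := by
  rw [l2Form_apply, tsum_eq_sum (s := t) fun g hg => ?_]
  · simp only [sq]
  · have : a.coeff g = 0 := by simpa using fun h => hg (ht h)
    simp [this]

lemma sq_coeff_le_l2Form_self (a : MonoidAlgebra ℝ G) (g : G) :
    a.coeff g ^ 2 ≤ l2Form G a a := by
  rw [l2Form_apply, sq]
  exact (summable_coeff_mul_coeff a a).le_tsum g fun _ _ => mul_self_nonneg _

lemma l2Form_self_le_of_coeff {a b : MonoidAlgebra ℝ G}
    (h : ∀ g, a.coeff g ^ 2 ≤ b.coeff g ^ 2) : l2Form G a a ≤ l2Form G b b := by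
  refine (summable_coeff_mul_coeff a a).tsum_le_tsum (fun g => ?_) (summable_coeff_mul_coeff b b)
  simpa only [sq] using h g

section ExpTest

/-- The test function `g ↦ (exp (-a ℓ(g)) - exp (-a r))₊`, supported on `{ℓ ≤ r}`. -/
noncomputable def expTest (ℓ : G → ℕ) {a : ℝ} (ha : 0 ≤ a) {r : ℕ}
    (hfin : {g | ℓ g ≤ r}.Finite) : MonoidAlgebra ℝ G :=
  ofCoeff <| Finsupp.onFinset hfin.toFinset
    (fun g => max (Real.exp (-(a * ℓ g)) - Real.exp (-(a * r))) 0)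
    fun g hg => by
      rw [Set.Finite.mem_toFinset, Set.mem_ofPred_eq]
      by_contra! h
      refine hg (max_eq_right (sub_nonpos.2 (Real.exp_le_exp.2 ?_)))
      gcongr

variable {ℓ : G → ℕ} {a : ℝ} (ha : 0 ≤ a) {r : ℕ} (hfin : {g | ℓ g ≤ r}.Finite)

lemma coeff_expTest (g : G) : (expTest ℓ ha hfin).coeff g =
    max (Real.exp (-(a * ℓ g)) - Real.exp (-(a * r))) 0 := rfl

lemma coeff_expTest_nonneg (g : G) : 0 ≤ (expTest ℓ ha hfin).coeff g := le_max_right _ _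

lemma coeff_expTest_of_lt {g : G} (hg : r < ℓ g) : (expTest ℓ ha hfin).coeff g = 0 := by
  refine max_eq_right (sub_nonpos.2 (Real.exp_le_exp.2 ?_))
  gcongr

lemma support_expTest_subset : (expTest ℓ ha hfin).coeff.support ⊆ hfin.toFinset := by
  intro g hg
  rw [Set.Finite.mem_toFinset, Set.mem_ofPred_eq]
  by_contra! h
  exact Finsupp.mem_support_iff.1 hg (coeff_expTest_of_lt ha hfin h)

lemma abs_exp_sub_exp_le (ha : 0 ≤ a) {x y : ℝ} (hxy : x ≤ y + 1) (hyx : y ≤ x + 1) :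
    |Real.exp (-(a * x)) - Real.exp (-(a * y))| ≤ (Real.exp a - 1) * Real.exp (-(a * y)) := by
  have hup : Real.exp (-(a * x)) ≤ Real.exp a * Real.exp (-(a * y)) := by
    rw [← Real.exp_add]
    gcongr
    nlinarith
  have hlow : Real.exp (-(a * y)) ≤ Real.exp a * Real.exp (-(a * x)) := by
    rw [← Real.exp_add]
    gcongr
    nlinarith
  have h1 : 1 ≤ Real.exp a := Real.one_le_exp ha
  have hx := Real.exp_pos (-(a * x))
  have hy := Real.exp_pos (-(a * y))
  rw [abs_le]
  constructor
  · rcases le_total (Real.exp (-(a * y))) (Real.exp (-(a * x))) with h | h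
    · nlinarith
    · nlinarith
  · linarith

lemma exp_sub_one_le_mul_exp (x : ℝ) : Real.exp x - 1 ≤ x * Real.exp x := by
  have h := mul_le_mul_of_nonneg_right (Real.one_sub_le_exp_neg x) (Real.exp_pos x).le
  rw [← Real.exp_add, neg_add_cancel, Real.exp_zero] at h
  linarith

lemma sq_one_sub_exp_neg_le_l2Form {K : ℝ} {g₀ : G} (hg₀ : ℓ g₀ = 0)
    (hKr : K ≤ a * r) (hK : 0 < K) :
    (1 - Real.exp (-K)) ^ 2 ≤ l2Form G (expTest ℓ ha hfin) (expTest ℓ ha hfin) := by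
  refine le_trans ?_ (sq_coeff_le_l2Form_self _ g₀)
  have h1 : Real.exp (-K) < 1 := Real.exp_lt_one_iff.2 (by linarith)
  refine pow_le_pow_left₀ (by linarith) (le_trans ?_ (le_max_left _ _)) 2
  rw [hg₀, Nat.cast_zero, mul_zero, neg_zero, Real.exp_zero]
  gcongr

end ExpTest

variable [Group G]

lemma coeff_single_one_mul_eq (s : G) (a : MonoidAlgebra ℝ G) (g : G) :
    (single s 1 * a).coeff g = a.coeff (s⁻¹ * g) := by
  rw [coeff_single_mul_eq_mul_coeff (s⁻¹ * g), one_mul]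
  intro m _
  exact eq_inv_mul_iff_mul_eq.symm

lemma coeff_mul_single_one_eq (s : G) (a : MonoidAlgebra ℝ G) (g : G) :
    (a * single s 1).coeff g = a.coeff (g * s⁻¹) := by
  rw [coeff_mul_single_eq_coeff_mul (g * s⁻¹), mul_one]
  intro m _
  exact eq_mul_inv_iff_mul_eq.symm

lemma l2Form_single_mul_left (s : G) (a b : MonoidAlgebra ℝ G) :
    l2Form G (single s 1 * a) b = l2Form G a (single s⁻¹ 1 * b) := by
  simp only [l2Form_apply, coeff_single_one_mul_eq, inv_inv]
  rw [← (Equiv.mulLeft s).tsum_eq]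
  simp

lemma l2Form_single_mul_single_mul (s : G) (a b : MonoidAlgebra ℝ G) :
    l2Form G (single s 1 * a) (single s 1 * b) = l2Form G a b := by
  rw [l2Form_single_mul_left, ← mul_assoc, single_mul_single]
  simp [← one_def]

lemma l2Form_mul_single_mul_single (s : G) (a b : MonoidAlgebra ℝ G) :
    l2Form G (a * single s 1) (b * single s 1) = l2Form G a b := by
  simp only [l2Form_apply, coeff_mul_single_one_eq]
  exact (Equiv.mulRight s⁻¹).tsum_eq fun g => a.coeff g * b.coeff g

lemma l2Form_one_left (a : MonoidAlgebra ℝ G) : l2Form G 1 a = a.coeff 1 := by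
  rw [l2Form_apply, tsum_eq_single 1 fun g hg => ?_]
  · simp [one_def]
  · simp [one_def, hg.symm]

/-- Young-type bound: convolving with `f` scales the squared `ℓ²` norm by at most
`‖f‖₁² ≤ |supp f| ‖f‖₂²`. -/
lemma l2Form_mul_self_le (q f : MonoidAlgebra ℝ G) {t : Finset G} (ht : f.coeff.support ⊆ t) :
    l2Form G (q * f) (q * f) ≤ t.card * l2Form G f f * l2Form G q q := by
  have hf : f = ∑ x ∈ t, f.coeff x • single x (1 : ℝ) := by
    conv_lhs => rw [← sum_coeff_single f]
    rw [Finsupp.sum_of_support_subset _ ht _ (by simp)]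
    simp
  have hcoeff (g : G) : (q * f).coeff g = ∑ x ∈ t, f.coeff x * (q * single x 1).coeff g := by
    conv_lhs => rw [hf]
    simp [Finset.mul_sum, coeff_sum, mul_comm]
  have hsum : Summable fun g => ∑ x ∈ t, (q * single x 1).coeff g * (q * single x 1).coeff g :=
    summable_sum fun x _ => summable_coeff_mul_coeff _ _
  calc l2Form G (q * f) (q * f)
      ≤ ∑' g, l2Form G f f * ∑ x ∈ t, (q * single x 1).coeff g * (q * single x 1).coeff g := by
        refine (summable_coeff_mul_coeff _ _).tsum_le_tsum (fun g => ?_) (hsum.mul_left _)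
        rw [hcoeff, ← sq, l2Form_self_eq_sum ht]
        simpa only [sq] using Finset.sum_mul_sq_le_sq_mul_sq t f.coeff
          fun x => (q * single x 1).coeff g
    _ = t.card * l2Form G f f * l2Form G q q := by
        rw [tsum_mul_left, Summable.tsum_finsetSum fun x _ => summable_coeff_mul_coeff _ _]
        simp only [← l2Form_apply, l2Form_mul_single_mul_single, Finset.sum_const, nsmul_eq_mul]
        ring

/-- For a self-adjoint `p`, the ratios `‖p^(k+1) f‖² / ‖p^k f‖²` are nondecreasing, so a lower
bound on the first one propagates. -/
lemma pow_mul_l2Form_self_le {p : MonoidAlgebra ℝ G}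
    (hp : ∀ a b, l2Form G (p * a) b = l2Form G a (p * b)) {f : MonoidAlgebra ℝ G} {ρ : ℝ}
    (hρ : 0 ≤ ρ) (h : ρ * l2Form G f f ≤ l2Form G (p * f) (p * f)) (n : ℕ) :
    ρ ^ n * l2Form G f f ≤ l2Form G (p ^ n * f) (p ^ n * f) := by
  have hstep (k : ℕ) : ρ * l2Form G (p ^ k * f) (p ^ k * f) ≤
      l2Form G (p ^ (k + 1) * f) (p ^ (k + 1) * f) := by
    induction k with
    | zero => simpa using h
    | succ k ih =>
      have hcs := l2Form_sq_le (p ^ k * f) (p ^ (k + 1 + 1) * f)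
      have hshift : l2Form G (p ^ k * f) (p ^ (k + 1 + 1) * f) =
          l2Form G (p ^ (k + 1) * f) (p ^ (k + 1) * f) := by
        rw [pow_succ' p (k + 1), mul_assoc, ← hp, ← mul_assoc, ← pow_succ']
      rw [hshift] at hcs
      have h0 := l2Form_self_nonneg (p ^ k * f)
      have h1 := l2Form_self_nonneg (p ^ (k + 1) * f)
      have h2 := l2Form_self_nonneg (p ^ (k + 1 + 1) * f)
      rcases h0.eq_or_lt with h0 | h0
      · rw [← h0, zero_mul] at hcs
        rw [pow_eq_zero_iff two_ne_zero |>.1 (le_antisymm hcs (sq_nonneg _)), mul_zero]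
        exact h2
      · refine le_of_mul_le_mul_left ?_ h0
        nlinarith [mul_le_mul_of_nonneg_right ih h1]
  induction n with
  | zero => simp
  | succ n ih =>
    calc ρ ^ (n + 1) * l2Form G f f = ρ * (ρ ^ n * l2Form G f f) := by ring
      _ ≤ ρ * l2Form G (p ^ n * f) (p ^ n * f) := by gcongr
      _ ≤ _ := hstep n

/-- The lazy walk measure as an element of the group algebra. -/
noncomputable def lazyWalkElt (S : Finset G) : MonoidAlgebra ℝ G :=
  (1 / 2 : ℝ) • 1 + (1 / (2 * (S.card : ℝ))) • ∑ s ∈ S, single s 1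

lemma coeff_lazyWalkElt (S : Finset G) (g : G) : (lazyWalkElt S).coeff g = lazyWalk S g := by
  simp only [lazyWalkElt, lazyWalk, coeff_add, coeff_smul, coeff_sum, one_def, coeff_single,
    Finsupp.add_apply, Finsupp.smul_apply, Finsupp.finsetSum_apply, Finsupp.single_apply,
    smul_eq_mul, eq_comm (a := (1 : G)), Finset.sum_ite_eq']
  split_ifs <;> simp

lemma convPow_lazyWalk (S : Finset G) (n : ℕ) (g : G) :
    convPow (lazyWalk S) n g = (lazyWalkElt S ^ n).coeff g := by
  induction n generalizing g with
  | zero => simp [convPow, one_def, Finsupp.single_apply, eq_comm]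
  | succ n ih =>
    simp only [convPow, ih, ← coeff_lazyWalkElt]
    rw [pow_succ, coeff_mul, Finsupp.sum, tsum_eq_sum (s := (lazyWalkElt S ^ n).coeff.support)]
    · refine Finset.sum_congr rfl fun h _ => ?_
      simp only [← eq_inv_mul_iff_mul_eq]
      simp +contextual
    · intro h hh
      simp [Finsupp.notMem_support_iff.1 hh]

section LazyWalk

variable {S : Finset G}

lemma l2Form_lazyWalkElt_mul (hsym : ∀ s ∈ S, s⁻¹ ∈ S) (a b : MonoidAlgebra ℝ G) :
    l2Form G (lazyWalkElt S * a) b = l2Form G a (lazyWalkElt S * b) := by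
  simp only [lazyWalkElt, add_mul, smul_mul_assoc, one_mul, Finset.sum_mul, map_add, map_smul,
    map_sum, LinearMap.add_apply, LinearMap.smul_apply, LinearMap.sum_apply,
    l2Form_single_mul_left]
  congr 2
  exact Finset.sum_nbij' (·⁻¹) (·⁻¹) hsym hsym (by simp) (by simp) (by simp)

lemma coeff_one_lazyWalkElt_pow (hsym : ∀ s ∈ S, s⁻¹ ∈ S) (n : ℕ) :
    (lazyWalkElt S ^ (2 * n)).coeff 1 =
    l2Form G (lazyWalkElt S ^ n) (lazyWalkElt S ^ n) := by
  have hmove (n : ℕ) : ∀ b, l2Form G (lazyWalkElt S ^ n) b =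
      l2Form G 1 (lazyWalkElt S ^ n * b) := by
    induction n with
    | zero => simp
    | succ n ih =>
      intro b
      rw [pow_succ', l2Form_lazyWalkElt_mul hsym, ih, ← mul_assoc, ← pow_succ, pow_succ']
  rw [hmove, l2Form_one_left, ← pow_add, two_mul]

lemma quarter_mul_l2Form_self_le {f : MonoidAlgebra ℝ G} (hf : ∀ g, 0 ≤ f.coeff g) :
    1 / 4 * l2Form G f f ≤ l2Form G (lazyWalkElt S * f) (lazyWalkElt S * f) := by
  have hle (g : G) : 1 / 2 * f.coeff g ≤ (lazyWalkElt S * f).coeff g := by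
    simp only [lazyWalkElt, add_mul, smul_mul_assoc, one_mul, Finset.sum_mul, coeff_add,
      coeff_smul, coeff_sum, Finsupp.add_apply, Finsupp.smul_apply, Finsupp.finsetSum_apply,
      smul_eq_mul, coeff_single_one_mul_eq]
    have : 0 ≤ ∑ s ∈ S, f.coeff (s⁻¹ * g) := Finset.sum_nonneg fun s _ => hf _
    have : 0 ≤ 1 / (2 * (S.card : ℝ)) * ∑ s ∈ S, f.coeff (s⁻¹ * g) := by positivity
    linarith
  have h := l2Form_self_le_of_coeff (a := (1 / 2 : ℝ) • f) (b := lazyWalkElt S * f) fun g => by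
    rw [coeff_smul, Finsupp.smul_apply, smul_eq_mul]
    exact pow_le_pow_left₀ (mul_nonneg (by norm_num) (hf g)) (hle g) 2
  simp only [map_smul, LinearMap.smul_apply, smul_eq_mul] at h
  linarith

lemma mul_l2Form_self_le_of_energy (hSne : S.Nonempty) {f : MonoidAlgebra ℝ G} {Λ : ℝ}
    (hE : ∀ s ∈ S, l2Form G (single s 1 * f - f) (single s 1 * f - f) ≤ Λ * l2Form G f f) :
    (1 - Λ / 2) * l2Form G f f ≤ l2Form G (lazyWalkElt S * f) (lazyWalkElt S * f) := by
  have hcorr : ∀ s ∈ S, (1 - Λ / 2) * l2Form G f f ≤ l2Form G (single s 1 * f) f := by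
    intro s hs
    have := hE s hs
    simp only [map_sub, LinearMap.sub_apply, l2Form_single_mul_single_mul] at this
    rw [l2Form_comm f (single s 1 * f)] at this
    linarith
  have hcard : (0 : ℝ) < S.card := by exact_mod_cast hSne.card_pos
  have hsum : S.card * ((1 - Λ / 2) * l2Form G f f) ≤ ∑ s ∈ S, l2Form G (single s 1 * f) f := by
    simpa using Finset.sum_le_sum hcorr
  have hpf : l2Form G (lazyWalkElt S * f) f = 1 / 2 * l2Form G f f +
      1 / (2 * (S.card : ℝ)) * ∑ s ∈ S, l2Form G (single s 1 * f) f := by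
    simp only [lazyWalkElt, add_mul, smul_mul_assoc, one_mul, Finset.sum_mul, map_add, map_smul,
      map_sum, LinearMap.add_apply, LinearMap.smul_apply, LinearMap.sum_apply, smul_eq_mul]
  have hpf' : 1 / 2 * ((1 - Λ / 2) * l2Form G f f) ≤
      1 / (2 * (S.card : ℝ)) * ∑ s ∈ S, l2Form G (single s 1 * f) f := by
    calc 1 / 2 * ((1 - Λ / 2) * l2Form G f f)
        = 1 / (2 * (S.card : ℝ)) * (S.card * ((1 - Λ / 2) * l2Form G f f)) := by field_simp
      _ ≤ _ := by gcongr
  have hnn := l2Form_self_nonneg (lazyWalkElt S * f - f)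
  simp only [map_sub, LinearMap.sub_apply] at hnn
  rw [l2Form_comm f (lazyWalkElt S * f)] at hnn
  linarith

/-- A nonnegative test function with small Dirichlet energy and small support bounds the return
probability of the lazy walk from below. -/
lemma exp_le_card_mul_coeff_one (hsym : ∀ s ∈ S, s⁻¹ ∈ S) (hSne : S.Nonempty)
    {f : MonoidAlgebra ℝ G} {t : Finset G}
    (ht : f.coeff.support ⊆ t) (hf : ∀ g, 0 ≤ f.coeff g) (hpos : 0 < l2Form G f f) {Λ : ℝ}
    (hΛ : 0 ≤ Λ)
    (hE : ∀ s ∈ S, l2Form G (single s 1 * f - f) (single s 1 * f - f) ≤ Λ * l2Form G f f)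
    (n : ℕ) :
    Real.exp (-(3 * Λ * n)) ≤ t.card * (lazyWalkElt S ^ (2 * n)).coeff 1 := by
  have hexp : Real.exp (-(3 * Λ)) ≤ (1 + 3 * Λ)⁻¹ := by
    rw [Real.exp_neg]
    gcongr
    linarith [Real.add_one_le_exp (3 * Λ)]
  have hstep : Real.exp (-(3 * Λ)) * l2Form G f f ≤
      l2Form G (lazyWalkElt S * f) (lazyWalkElt S * f) := by
    rcases le_total Λ 1 with h1 | h1
    · refine le_trans ?_ (mul_l2Form_self_le_of_energy hSne hE)
      gcongr
      refine hexp.trans ?_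
      rw [inv_le_iff_one_le_mul₀ (by positivity)]
      nlinarith
    · refine le_trans ?_ (quarter_mul_l2Form_self_le hf)
      gcongr
      refine hexp.trans ?_
      rw [inv_le_iff_one_le_mul₀ (by positivity)]
      linarith
  have hlow := pow_mul_l2Form_self_le (l2Form_lazyWalkElt_mul hsym) (Real.exp_pos _).le hstep n
  have hup := l2Form_mul_self_le (lazyWalkElt S ^ n) f ht
  rw [coeff_one_lazyWalkElt_pow hsym]
  have hpow : Real.exp (-(3 * Λ * n)) = Real.exp (-(3 * Λ)) ^ n := by
    rw [← Real.exp_nat_mul]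
    ring_nf
  rw [hpow]
  refine le_of_mul_le_mul_right ?_ hpos
  linarith

end LazyWalk

section ExpTest

variable {ℓ : G → ℕ} {a : ℝ} (ha : 0 ≤ a) {r : ℕ} (hfin : {g | ℓ g ≤ r}.Finite)

lemma sq_coeff_sub_expTest_le {s : G} (hs : ∀ g, ℓ (s⁻¹ * g) ≤ ℓ g + 1)
    (hs' : ∀ g, ℓ g ≤ ℓ (s⁻¹ * g) + 1) (g : G) :
    (single s 1 * expTest ℓ ha hfin - expTest ℓ ha hfin).coeff g ^ 2 ≤
      (Real.exp a - 1) ^ 2 *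
        (2 * (expTest ℓ ha hfin).coeff g ^ 2 + 2 * Real.exp (-(a * r)) ^ 2) := by
  have habs : |(single s 1 * expTest ℓ ha hfin - expTest ℓ ha hfin).coeff g| ≤
      (Real.exp a - 1) * Real.exp (-(a * ℓ g)) := by
    rw [coeff_sub, Finsupp.sub_apply, coeff_single_one_mul_eq, coeff_expTest, coeff_expTest]
    refine (abs_max_sub_max_le_abs _ _ _).trans ?_
    rw [sub_sub_sub_cancel_right]
    exact abs_exp_sub_exp_le ha (by exact_mod_cast hs g) (by exact_mod_cast hs' g)
  have hq : Real.exp (-(a * ℓ g)) ≤ (expTest ℓ ha hfin).coeff g + Real.exp (-(a * r)) := by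
    rw [coeff_expTest]
    linarith [le_max_left (Real.exp (-(a * ℓ g)) - Real.exp (-(a * r))) 0]
  have hq2 : Real.exp (-(a * ℓ g)) ^ 2 ≤
      2 * (expTest ℓ ha hfin).coeff g ^ 2 + 2 * Real.exp (-(a * r)) ^ 2 := by
    refine (pow_le_pow_left₀ (Real.exp_pos _).le hq 2).trans ?_
    linarith [add_sq_le (a := (expTest ℓ ha hfin).coeff g) (b := Real.exp (-(a * r)))]
  rw [← sq_abs]
  refine (pow_le_pow_left₀ (abs_nonneg _) habs 2).trans ?_
  rw [mul_pow]
  gcongr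

lemma l2Form_sub_expTest_le (hfin' : {g | ℓ g ≤ r + 1}.Finite) {s : G}
    (hs : ∀ g, ℓ (s⁻¹ * g) ≤ ℓ g + 1) (hs' : ∀ g, ℓ g ≤ ℓ (s⁻¹ * g) + 1) :
    l2Form G (single s 1 * expTest ℓ ha hfin - expTest ℓ ha hfin)
      (single s 1 * expTest ℓ ha hfin - expTest ℓ ha hfin) ≤
    (Real.exp a - 1) ^ 2 * (2 * l2Form G (expTest ℓ ha hfin) (expTest ℓ ha hfin) +
      2 * (Real.exp (-(a * r)) ^ 2 * hfin'.toFinset.card)) := by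
  have hsupp : (expTest ℓ ha hfin).coeff.support ⊆ hfin'.toFinset :=
    (support_expTest_subset ha hfin).trans <| by
      simpa using fun g hg => Nat.le_succ_of_le hg
  have hsupp' : (single s 1 * expTest ℓ ha hfin - expTest ℓ ha hfin).coeff.support ⊆
      hfin'.toFinset := by
    intro g hg
    rw [Set.Finite.mem_toFinset, Set.mem_ofPred_eq]
    by_contra! h
    refine Finsupp.mem_support_iff.1 hg ?_
    rw [coeff_sub, Finsupp.sub_apply, coeff_single_one_mul_eq,
      coeff_expTest_of_lt ha hfin (by have := hs' g; omega),
      coeff_expTest_of_lt ha hfin (by omega), sub_zero]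
  rw [l2Form_self_eq_sum hsupp', l2Form_self_eq_sum hsupp]
  refine (Finset.sum_le_sum fun g _ => sq_coeff_sub_expTest_le ha hfin hs hs' g).trans_eq ?_
  rw [← Finset.mul_sum, Finset.sum_add_distrib, ← Finset.mul_sum, Finset.sum_const, nsmul_eq_mul]
  ring

/-- The Rayleigh quotient estimate for the exponential test function with rate `K r^(ν - 1)` when
the volume grows at most like `exp (K r^ν)`. -/
lemma energy_expTest_le {K L ν : ℝ} (hK : 0 < K) (hL : 0 < L) (hν0 : 0 < ν) (hν1 : ν ≤ 1)
    (hr : 1 ≤ r) (haK : a = K * (r : ℝ) ^ (ν - 1)) {g₀ : G} (hg₀ : ℓ g₀ = 0)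
    (hfin' : {g | ℓ g ≤ r + 1}.Finite)
    (hcard : (hfin'.toFinset.card : ℝ) ≤ L * Real.exp (K * ((r + 1 : ℕ) : ℝ) ^ ν)) {s : G}
    (hs : ∀ g, ℓ (s⁻¹ * g) ≤ ℓ g + 1) (hs' : ∀ g, ℓ g ≤ ℓ (s⁻¹ * g) + 1) :
    l2Form G (single s 1 * expTest ℓ ha hfin - expTest ℓ ha hfin)
      (single s 1 * expTest ℓ ha hfin - expTest ℓ ha hfin) ≤
    (K * Real.exp K) ^ 2 * (2 + 2 * (L / (1 - Real.exp (-K)) ^ 2)) * ((r : ℝ) ^ (ν - 1)) ^ 2 *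
      l2Form G (expTest ℓ ha hfin) (expTest ℓ ha hfin) := by
  have hr1 : (1 : ℝ) ≤ r := by exact_mod_cast hr
  have hr0 : (0 : ℝ) < r := by linarith
  have har : a * r = K * (r : ℝ) ^ ν := by
    rw [haK, Real.rpow_sub_one hr0.ne']
    field_simp
  have haK' : a ≤ K := by
    rw [haK]
    exact mul_le_of_le_one_right hK.le (Real.rpow_le_one_of_one_le_of_nonpos hr1 (by linarith))
  have hvol : Real.exp (-(a * r)) ^ 2 * hfin'.toFinset.card ≤ L := by
    have hpow : ((r + 1 : ℕ) : ℝ) ^ ν ≤ 2 * (r : ℝ) ^ ν := by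
      calc ((r + 1 : ℕ) : ℝ) ^ ν ≤ (2 * (r : ℝ)) ^ ν := by
            gcongr
            push_cast
            linarith
        _ = 2 ^ ν * (r : ℝ) ^ ν := Real.mul_rpow (by norm_num) hr0.le
        _ ≤ 2 * (r : ℝ) ^ ν := by
            gcongr
            exact Real.rpow_le_self_of_one_le (by norm_num) hν1
    calc Real.exp (-(a * r)) ^ 2 * hfin'.toFinset.card
        ≤ Real.exp (-(a * r)) ^ 2 * (L * Real.exp (2 * (a * r))) := by
          gcongr
          refine hcard.trans ?_
          rw [har]
          gcongr L * Real.exp ?_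
          nlinarith
      _ = L * (Real.exp (2 * -(a * r)) * Real.exp (2 * (a * r))) := by
          rw [two_mul (-(a * r)), Real.exp_add]
          ring
      _ = L := by
          rw [← Real.exp_add]
          simp
  have hδ : 0 < (1 - Real.exp (-K)) ^ 2 := by
    have h1 : Real.exp (-K) < 1 := Real.exp_lt_one_iff.2 (by linarith)
    exact pow_pos (by linarith) 2
  have hnorm := sq_one_sub_exp_neg_le_l2Form ha hfin (K := K) hg₀
    (har ▸ le_mul_of_one_le_right hK.le (Real.one_le_rpow hr1 hν0.le)) hK
  have hLle : L ≤ L / (1 - Real.exp (-K)) ^ 2 *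
      l2Form G (expTest ℓ ha hfin) (expTest ℓ ha hfin) := by
    rw [div_mul_eq_mul_div, le_div_iff₀ hδ]
    gcongr
  have hexp : Real.exp a - 1 ≤ K * Real.exp K * (r : ℝ) ^ (ν - 1) := by
    refine (exp_sub_one_le_mul_exp a).trans ?_
    calc a * Real.exp a ≤ a * Real.exp K := by gcongr
      _ = K * Real.exp K * (r : ℝ) ^ (ν - 1) := by rw [haK]; ring
  refine (l2Form_sub_expTest_le ha hfin hfin' hs hs').trans ?_
  calc (Real.exp a - 1) ^ 2 * (2 * l2Form G (expTest ℓ ha hfin) (expTest ℓ ha hfin) +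
        2 * (Real.exp (-(a * r)) ^ 2 * hfin'.toFinset.card))
      ≤ (K * Real.exp K * (r : ℝ) ^ (ν - 1)) ^ 2 *
        (2 * l2Form G (expTest ℓ ha hfin) (expTest ℓ ha hfin) +
          2 * (L / (1 - Real.exp (-K)) ^ 2 *
            l2Form G (expTest ℓ ha hfin) (expTest ℓ ha hfin))) := by
        have := l2Form_self_nonneg (expTest ℓ ha hfin)
        have h0 : 0 ≤ Real.exp a - 1 := sub_nonneg.2 (Real.one_le_exp ha)
        gcongr ?_ ^ 2 * (_ + 2 * ?_)
        · exact hvol.trans hLle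
    _ = _ := by ring

end ExpTest

end MonoidAlgebra

section WordLength

variable {G : Type*} [Group G] {S : Set G}

lemma wordLength_one : wordLength S (1 : G) = 0 :=
  Nat.sInf_eq_zero.2 (Or.inl ⟨[], by simp⟩)

lemma exists_list_length_eq_wordLength (hsym : ∀ s ∈ S, s⁻¹ ∈ S)
    (hgen : Subgroup.closure S = ⊤) (g : G) :
    ∃ l : List G, (∀ x ∈ l, x ∈ S) ∧ l.length = wordLength S g ∧ l.prod = g := by
  have hg : g ∈ (Subgroup.closure S).toSubmonoid := by simp [hgen]
  rw [Subgroup.closure_toSubmonoid] at hg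
  obtain ⟨l, hl, hprod⟩ := Submonoid.exists_list_of_mem_closure hg
  exact Nat.sInf_mem (s := {n | ∃ l : List G, (∀ x ∈ l, x ∈ S) ∧ l.length = n ∧ l.prod = g})
    ⟨l.length, l, fun x hx => (hl x hx).elim id fun h => inv_inv x ▸ hsym _ h, rfl, hprod⟩

lemma wordLength_mul_le (hsym : ∀ s ∈ S, s⁻¹ ∈ S) (hgen : Subgroup.closure S = ⊤) {s : G}
    (hs : s ∈ S) (g : G) : wordLength S (s * g) ≤ wordLength S g + 1 := by
  obtain ⟨l, hl, hlen, hprod⟩ := exists_list_length_eq_wordLength hsym hgen g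
  exact Nat.sInf_le ⟨s :: l, by simpa using ⟨hs, hl⟩, by simp [hlen], by simp [hprod]⟩

end WordLength

/-- The radius `r ≍ n^(1/(2-ν))` balances the volume term `r^ν` against the energy term
`n r^(2ν-2)`. -/
lemma exists_radius {ν : ℝ} (hν0 : 0 < ν) (hν1 : ν ≤ 1) {n : ℕ} (hn : 1 ≤ n) :
    ∃ r : ℕ, 1 ≤ r ∧ (r : ℝ) ^ ν ≤ 2 * (n : ℝ) ^ (ν / (2 - ν)) ∧
      ((r : ℝ) ^ (ν - 1)) ^ 2 * n ≤ (n : ℝ) ^ (ν / (2 - ν)) := by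
  have hn1 : (1 : ℝ) ≤ n := by exact_mod_cast hn
  have hn0 : (0 : ℝ) < n := by linarith
  have hd : (0 : ℝ) < 2 - ν := by linarith
  set N : ℝ := (n : ℝ) ^ (1 / (2 - ν)) with hN
  have hN1 : 1 ≤ N := Real.one_le_rpow hn1 (by positivity)
  have hN0 : 0 < N := by linarith
  have hNν : N ^ ν = (n : ℝ) ^ (ν / (2 - ν)) := by
    rw [hN, ← Real.rpow_mul hn0.le]
    ring_nf
  have hle : N ≤ (⌈N⌉₊ : ℝ) := Nat.le_ceil N
  have hlt : (⌈N⌉₊ : ℝ) < N + 1 := Nat.ceil_lt_add_one hN0.le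
  refine ⟨⌈N⌉₊, Nat.one_le_ceil_iff.2 hN0, ?_, ?_⟩
  · rw [← hNν]
    calc (⌈N⌉₊ : ℝ) ^ ν ≤ (2 * N) ^ ν := by
          gcongr
          linarith
      _ = 2 ^ ν * N ^ ν := Real.mul_rpow (by norm_num) hN0.le
      _ ≤ 2 * N ^ ν := by
          gcongr
          exact Real.rpow_le_self_of_one_le (by norm_num) hν1
  · calc ((⌈N⌉₊ : ℝ) ^ (ν - 1)) ^ 2 * n ≤ (N ^ (ν - 1)) ^ 2 * n := by
          gcongr ?_ ^ 2 * _
          exact Real.rpow_le_rpow_of_nonpos hN0 hle (by linarith)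
      _ = (n : ℝ) ^ (ν / (2 - ν)) := by
          rw [hN, ← Real.rpow_mul hn0.le, ← Real.rpow_mul_natCast hn0.le]
          nth_rewrite 2 [← Real.rpow_one (n : ℝ)]
          rw [← Real.rpow_add hn0]
          congr 1
          push_cast
          field_simp
          ring

/-- if `|B_n| ≤ L exp(K n^ν)` and `|B_n| ≥ c n²`, then
`P^{(2n)}(e) ≥ L'' exp(−K'' n^{ν/(2−ν)})`. -/
theorem stmt15 {G : Type*} [Group G] (S : Finset G)
    (hS1 : (1 : G) ∉ S) (hSne : S.Nonempty) (hsym : ∀ s ∈ S, s⁻¹ ∈ S)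
    (hgen : Subgroup.closure (S : Set G) = ⊤)
    (K L ν : ℝ) (hK : 0 < K) (hL : 0 < L) (hν0 : 0 < ν) (hν1 : ν ≤ 1)
    (hvol : ∀ n : ℕ, 1 ≤ n →
      (Nat.card ↥(ball (S : Set G) n) : ℝ) ≤ L * Real.exp (K * (n : ℝ) ^ ν))
    (c : ℝ) (hc : 0 < c)
    (hvol2 : ∀ n : ℕ, 1 ≤ n → c * (n : ℝ) ^ 2 ≤ (Nat.card ↥(ball (S : Set G) n) : ℝ)) :
    ∃ K'' L'' : ℝ, 0 < K'' ∧ 0 < L'' ∧ ∀ n : ℕ, 1 ≤ n →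
      L'' * Real.exp (-K'' * (n : ℝ) ^ (ν / (2 - ν))) ≤
        convPow (lazyWalk S) (2 * n) 1 := by
  have hcardpos (n : ℕ) (hn : 1 ≤ n) : 0 < Nat.card ↥(ball (S : Set G) n) := by
    have hn0 : (0 : ℝ) < n := by exact_mod_cast hn
    have h : (0 : ℝ) < c * (n : ℝ) ^ 2 := by positivity
    exact_mod_cast h.trans_le (hvol2 n hn)
  have hfin (n : ℕ) (hn : 1 ≤ n) : {g | wordLength (S : Set G) g ≤ n}.Finite :=
    Set.finite_coe_iff.1 (Nat.finite_of_card_ne_zero (hcardpos n hn).ne')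
  have hcard (n : ℕ) (hn : 1 ≤ n) :
      ((hfin n hn).toFinset.card : ℝ) ≤ L * Real.exp (K * (n : ℝ) ^ ν) := by
    rw [← Set.ncard_eq_toFinset_card _ (hfin n hn), ← Nat.card_coe_set_eq]
    exact hvol n hn
  have hsymG : ∀ s ∈ (S : Set G), s⁻¹ ∈ (S : Set G) := fun s hs => hsym s hs
  have hδ : 0 < 1 - Real.exp (-K) := sub_pos.2 (Real.exp_lt_one_iff.2 (by linarith))
  set C : ℝ := (K * Real.exp K) ^ 2 * (2 + 2 * (L / (1 - Real.exp (-K)) ^ 2)) with hC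
  have hC0 : 0 < C := by positivity
  refine ⟨3 * C + 2 * K, L⁻¹, by positivity, by positivity, fun n hn => ?_⟩
  obtain ⟨r, hr, hrν, hrn⟩ := exists_radius hν0 hν1 hn
  have hr1 : (1 : ℝ) ≤ r := by exact_mod_cast hr
  have hr0 : (0 : ℝ) < r := by linarith
  have ha : 0 ≤ K * (r : ℝ) ^ (ν - 1) := by positivity
  have hpos : 0 < MonoidAlgebra.l2Form G (MonoidAlgebra.expTest _ ha (hfin r hr))
      (MonoidAlgebra.expTest _ ha (hfin r hr)) := by
    refine (pow_pos hδ 2).trans_le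
      (MonoidAlgebra.sq_one_sub_exp_neg_le_l2Form ha (hfin r hr) wordLength_one ?_ hK)
    rw [mul_assoc, ← Real.rpow_add_one hr0.ne', sub_add_cancel]
    exact le_mul_of_one_le_right hK.le (Real.one_le_rpow hr1 hν0.le)
  have hmain := MonoidAlgebra.exp_le_card_mul_coeff_one hsym hSne
    (MonoidAlgebra.support_expTest_subset ha (hfin r hr))
    (MonoidAlgebra.coeff_expTest_nonneg ha (hfin r hr)) hpos
    (Λ := C * ((r : ℝ) ^ (ν - 1)) ^ 2) (by positivity)
    (fun s hs => MonoidAlgebra.energy_expTest_le ha (hfin r hr) hK hL hν0 hν1 hr rfl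
      wordLength_one (hfin (r + 1) (by omega)) (hcard (r + 1) (by omega))
      (wordLength_mul_le hsymG hgen (hsymG s hs))
      (fun g => by simpa using wordLength_mul_le hsymG hgen (s := s) hs (s⁻¹ * g))) n
  rw [← MonoidAlgebra.convPow_lazyWalk] at hmain
  have hexp_pos := Real.exp_pos (-(3 * (C * ((r : ℝ) ^ (ν - 1)) ^ 2) * n))
  have hconv : 0 ≤ convPow (lazyWalk S) (2 * n) 1 :=
    (pos_of_mul_pos_right (hexp_pos.trans_le hmain) (Nat.cast_nonneg _)).le
  have hupper := hmain.trans (mul_le_mul_of_nonneg_right (hcard r hr) hconv)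
  rw [inv_mul_le_iff₀ hL]
  calc Real.exp (-(3 * C + 2 * K) * (n : ℝ) ^ (ν / (2 - ν)))
      ≤ Real.exp (-(K * (r : ℝ) ^ ν)) *
          Real.exp (-(3 * (C * ((r : ℝ) ^ (ν - 1)) ^ 2) * n)) := by
        rw [← Real.exp_add]
        gcongr
        nlinarith [mul_le_mul_of_nonneg_left hrν hK.le, mul_le_mul_of_nonneg_left hrn hC0.le]
    _ ≤ Real.exp (-(K * (r : ℝ) ^ ν)) *
          (L * Real.exp (K * (r : ℝ) ^ ν) * convPow (lazyWalk S) (2 * n) 1) := by gcongr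
    _ = L * convPow (lazyWalk S) (2 * n) 1 *
          (Real.exp (-(K * (r : ℝ) ^ ν)) * Real.exp (K * (r : ℝ) ^ ν)) := by ring
    _ = L * convPow (lazyWalk S) (2 * n) 1 := by
        rw [← Real.exp_add]
        simp
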